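/- arXiv:1504.04419 — 2 statements merged into one kernel-verified Lean document; each statement's English description precedes it below -/
import Mathlib

section
/- Let U and V be random vectors in ℝⁿ with finite second moments, both having (c₁,c₂)-regular densities. Then |h(U) − h(V)| ≤ Δ, where Δ = ( (c₁/2)·√(E[‖U‖²]) + (c₁/2)·√(E[‖V‖²]) + c₂ ) · W₂(P_U, P_V). -/
open MeasureTheory
open scoped ENNReal

noncomputable section

/-- Euclidean space ℝⁿ. -/
abbrev EucSp (n : ℕ) := EuclideanSpace ℝ (Fin n)

/-- A positive, differentiable density `p` on ℝⁿ is `(c₁, c₂)`-regular if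
`‖∇ log p(x)‖ ≤ c₁ ‖x‖ + c₂` for all `x`. -/
def RegularDensity (n : ℕ) (c₁ c₂ : ℝ) (p : EucSp n → ℝ) : Prop :=
  0 < c₁ ∧ 0 ≤ c₂ ∧ (∀ x, 0 < p x) ∧
    Differentiable ℝ (fun x => Real.log (p x)) ∧
    ∀ x, ‖gradient (fun y => Real.log (p y)) x‖ ≤ c₁ * ‖x‖ + c₂

/-- `γ` is a coupling of the probability measures `μ` and `ν` on ℝⁿ. -/
def IsCoupling {n : ℕ} (μ ν : Measure (EucSp n)) (γ : Measure (EucSp n × EucSp n)) : Prop :=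
  IsProbabilityMeasure γ ∧ γ.map Prod.fst = μ ∧ γ.map Prod.snd = ν

/-- The quadratic Wasserstein distance `W₂`. -/
def W2 {n : ℕ} (μ ν : Measure (EucSp n)) : ℝ :=
  sInf { r | ∃ γ, IsCoupling μ ν γ ∧ r = Real.sqrt (∫ z, ‖z.1 - z.2‖ ^ 2 ∂γ) }

/-- The 1-Wasserstein distance `W₁`. -/
def W1 {n : ℕ} (μ ν : Measure (EucSp n)) : ℝ :=
  sInf { r | ∃ γ, IsCoupling μ ν γ ∧ r = ∫ z, ‖z.1 - z.2‖ ∂γ }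

/-- The density of the Gaussian distribution `N(0, σ²Iₙ)` on ℝⁿ. -/
def gaussDensity (σ : ℝ) (n : ℕ) (z : EucSp n) : ℝ :=
  (2 * Real.pi * σ ^ 2) ^ (-(n : ℝ) / 2) * Real.exp (-‖z‖ ^ 2 / (2 * σ ^ 2))

/-- The Gaussian measure `N(0, σ²Iₙ)` on ℝⁿ. -/
def gaussMeasure (σ : ℝ) (n : ℕ) : Measure (EucSp n) :=
  volume.withDensity fun z => ENNReal.ofReal (gaussDensity σ n z)

/-- The distribution of the sum of two independent random vectors with laws `μ` and `ν`. -/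
def convMeasure {n : ℕ} (μ ν : Measure (EucSp n)) : Measure (EucSp n) :=
  (μ.prod ν).map fun p => p.1 + p.2

theorem reg_lip {n : ℕ} {c₁ c₂ : ℝ} {p : EucSp n → ℝ} (h : RegularDensity n c₁ c₂ p)
    (u v : EucSp n) :
    |Real.log (p v) - Real.log (p u)| ≤ (c₁ / 2 * ‖u‖ + c₁ / 2 * ‖v‖ + c₂) * ‖u - v‖ := by
  obtain ⟨h1, h2, h3, h4, h5⟩ := h
  set L : EucSp n → ℝ := fun x => Real.log (p x) with hL
  have hl : ∀ t : ℝ, HasDerivAt (fun t : ℝ => u + t • (v - u)) (v - u) t := by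
    intro t
    simpa using ((hasDerivAt_id t).smul_const (v - u)).const_add u
  have hf : ∀ t : ℝ, HasDerivAt (fun t : ℝ => L (u + t • (v - u)) - L u)
      (fderiv ℝ L (u + t • (v - u)) (v - u)) t := by
    intro t
    exact ((h4 (u + t • (v - u))).hasFDerivAt.comp_hasDerivAt t (hl t)).sub_const _
  have hB : ∀ t : ℝ, HasDerivAt
      (fun t : ℝ => (c₁ * (‖u‖ * (t - t ^ 2 / 2) + ‖v‖ * (t ^ 2 / 2)) + c₂ * t) * ‖u - v‖)
      ((c₁ * (‖u‖ * (1 - t) + ‖v‖ * t) + c₂) * ‖u - v‖) t := by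
    intro t
    have e1 : HasDerivAt (fun t : ℝ => t ^ 2 / 2) t t := by
      have := (hasDerivAt_pow 2 t).div_const 2
      simpa using this
    have e0 := hasDerivAt_id t
    have := (((((e0.sub e1).const_mul ‖u‖).add (e1.const_mul ‖v‖)).const_mul c₁).add
      (e0.const_mul c₂)).mul_const ‖u - v‖
    simpa using this
  have key := image_norm_le_of_norm_deriv_right_le_deriv_boundary (a := 0) (b := 1)
    (fun t _ => (hf t).continuousAt.continuousWithinAt) (fun t _ => (hf t).hasDerivWithinAt)
    (by simp) hB (by
      intro t ht
      have hg : ‖fderiv ℝ L (u + t • (v - u))‖ ≤ c₁ * ‖u + t • (v - u)‖ + c₂ := by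
        have := h5 (u + t • (v - u))
        rw [gradient] at this
        rwa [LinearIsometryEquiv.norm_map] at this
      have hx : ‖u + t • (v - u)‖ ≤ ‖u‖ * (1 - t) + ‖v‖ * t := by
        have : u + t • (v - u) = (1 - t) • u + t • v := by
          rw [smul_sub, sub_smul, one_smul]; abel
        rw [this]
        refine (norm_add_le _ _).trans_eq ?_
        rw [norm_smul, norm_smul, Real.norm_of_nonneg ht.1,
          Real.norm_of_nonneg (by linarith [ht.2])]
        ring
      refine (ContinuousLinearMap.le_opNorm _ _).trans ?_
      rw [norm_sub_rev v u]
      refine mul_le_mul_of_nonneg_right ?_ (norm_nonneg _)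
      refine hg.trans ?_
      gcongr) (Set.right_mem_Icc.2 zero_le_one)
  simp only [one_smul, add_sub_cancel, Real.norm_eq_abs] at key
  refine key.trans (le_of_eq ?_)
  ring

theorem reg_cont {n : ℕ} {c₁ c₂ : ℝ} {p : EucSp n → ℝ} (h : RegularDensity n c₁ c₂ p) :
    Continuous p := by
  have h1 := Real.continuous_exp.comp h.2.2.2.1.continuous
  have : Real.exp ∘ (fun x => Real.log (p x)) = p := by
    funext x
    exact Real.exp_log (h.2.2.1 x)
  rwa [this] at h1

theorem memLp_norm_two {α : Type*} [MeasurableSpace α] {n : ℕ} {μ : Measure α} {f : α → EucSp n}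
    (hf : AEStronglyMeasurable f μ) (h2 : Integrable (fun x => ‖f x‖ ^ 2) μ) : MemLp f 2 μ := by
  exact (memLp_two_iff_integrable_sq_norm hf).2 h2

theorem reg_int {n : ℕ} {c₁ c₂ : ℝ} {p : EucSp n → ℝ} (h : RegularDensity n c₁ c₂ p)
    {μ : Measure (EucSp n)} [IsProbabilityMeasure μ] (h2 : Integrable (fun x => ‖x‖ ^ 2) μ) :
    Integrable (fun x => Real.log (p x)) μ := by
  have hm : MemLp (fun x : EucSp n => x) 2 μ :=
    memLp_norm_two continuous_id.aestronglyMeasurable h2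
  have h1 : Integrable (fun x : EucSp n => ‖x‖) μ := (hm.integrable (by norm_num)).norm
  refine Integrable.mono' (((integrable_const |Real.log (p 0)|).add (h2.const_mul (c₁ / 2))).add
    (h1.const_mul c₂)) h.2.2.2.1.continuous.aestronglyMeasurable (Filter.Eventually.of_forall ?_)
  intro x
  have := reg_lip h 0 x
  simp only [norm_zero, mul_zero, zero_add, zero_sub, norm_neg] at this
  simp only [Pi.add_apply, Real.norm_eq_abs]
  have h3 := abs_sub_abs_le_abs_sub (Real.log (p x)) (Real.log (p 0))
  nlinarith

theorem cs_two {α : Type*} [MeasurableSpace α] {μ : Measure α} {f g : α → ℝ}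
    (hf : MemLp f 2 μ) (hg : MemLp g 2 μ) (hf0 : ∀ x, 0 ≤ f x) (hg0 : ∀ x, 0 ≤ g x) :
    ∫ x, f x * g x ∂μ ≤ Real.sqrt (∫ x, f x ^ 2 ∂μ) * Real.sqrt (∫ x, g x ^ 2 ∂μ) := by
  have := integral_mul_le_Lp_mul_Lq_of_nonneg (μ := μ) (f := f) (g := g)
    Real.HolderConjugate.two_two (Filter.Eventually.of_forall hf0)
    (Filter.Eventually.of_forall hg0) (by simpa using hf) (by simpa using hg)
  simpa [Real.sqrt_eq_rpow] using this

theorem coupling_bound {n : ℕ} {c₁ c₂ : ℝ} {p : EucSp n → ℝ} (h : RegularDensity n c₁ c₂ p)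
    {μU μV : Measure (EucSp n)} [IsProbabilityMeasure μU] [IsProbabilityMeasure μV]
    (hU2 : Integrable (fun x => ‖x‖ ^ 2) μU) (hV2 : Integrable (fun x => ‖x‖ ^ 2) μV)
    {γ : Measure (EucSp n × EucSp n)} (hγ : IsCoupling μU μV γ) :
    |(∫ x, Real.log (p x) ∂μV) - ∫ x, Real.log (p x) ∂μU| ≤
      (c₁ / 2 * Real.sqrt (∫ x, ‖x‖ ^ 2 ∂μU) + c₁ / 2 * Real.sqrt (∫ x, ‖x‖ ^ 2 ∂μV) + c₂) *
        Real.sqrt (∫ z, ‖z.1 - z.2‖ ^ 2 ∂γ) := by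
  obtain ⟨hp, hfst, hsnd⟩ := hγ
  have iU := reg_int h hU2
  have iV := reg_int h hV2
  subst hfst hsnd
  have c1 : Continuous (fun x : EucSp n => ‖x‖ ^ 2) := by fun_prop
  have hc := h.2.2.2.1.continuous
  have mf : AEMeasurable (Prod.fst : EucSp n × EucSp n → EucSp n) γ :=
    measurable_fst.aemeasurable
  have ms : AEMeasurable (Prod.snd : EucSp n × EucSp n → EucSp n) γ :=
    measurable_snd.aemeasurable
  rw [integral_map ms hc.aestronglyMeasurable, integral_map mf hc.aestronglyMeasurable,
    integral_map ms c1.aestronglyMeasurable, integral_map mf c1.aestronglyMeasurable]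
  rw [integrable_map_measure hc.aestronglyMeasurable mf] at iU
  rw [integrable_map_measure hc.aestronglyMeasurable ms] at iV
  rw [integrable_map_measure c1.aestronglyMeasurable mf] at hU2
  rw [integrable_map_measure c1.aestronglyMeasurable ms] at hV2
  have m1 : MemLp (fun z : EucSp n × EucSp n => z.1) 2 γ :=
    memLp_norm_two continuous_fst.aestronglyMeasurable hU2
  have m2 : MemLp (fun z : EucSp n × EucSp n => z.2) 2 γ :=
    memLp_norm_two continuous_snd.aestronglyMeasurable hV2
  have md : MemLp (fun z : EucSp n × EucSp n => ‖z.1 - z.2‖) 2 γ := (m1.sub m2).norm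
  have mo : MemLp (fun _ : EucSp n × EucSp n => (1 : ℝ)) 2 γ := memLp_const 1
  have b1 := cs_two m1.norm md (fun _ => norm_nonneg _) (fun _ => norm_nonneg _)
  have b2 := cs_two m2.norm md (fun _ => norm_nonneg _) (fun _ => norm_nonneg _)
  have b3 := cs_two mo md (fun _ => zero_le_one) (fun _ => norm_nonneg _)
  have j1 : Integrable (fun z : EucSp n × EucSp n => ‖z.1‖ * ‖z.1 - z.2‖) γ :=
    m1.norm.integrable_mul md
  have j2 : Integrable (fun z : EucSp n × EucSp n => ‖z.2‖ * ‖z.1 - z.2‖) γ :=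
    m2.norm.integrable_mul md
  have j3 : Integrable (fun z : EucSp n × EucSp n => 1 * ‖z.1 - z.2‖) γ :=
    mo.integrable_mul md
  have hc1 : 0 ≤ c₁ / 2 := by linarith [h.1]
  have hc2 : 0 ≤ c₂ := h.2.1
  have iU' : Integrable (fun z : EucSp n × EucSp n => Real.log (p z.1)) γ := iU
  have iV' : Integrable (fun z : EucSp n × EucSp n => Real.log (p z.2)) γ := iV
  rw [← integral_sub iV' iU']
  calc |∫ z, (Real.log (p z.2) - Real.log (p z.1)) ∂γ|
      ≤ ∫ z, |Real.log (p z.2) - Real.log (p z.1)| ∂γ := abs_integral_le_integral_abs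
    _ ≤ ∫ z, (c₁ / 2 * (‖z.1‖ * ‖z.1 - z.2‖) + c₁ / 2 * (‖z.2‖ * ‖z.1 - z.2‖)
          + c₂ * (1 * ‖z.1 - z.2‖)) ∂γ := by
        refine integral_mono (iV'.sub iU').abs
          (((j1.const_mul _).add (j2.const_mul _)).add (j3.const_mul _)) ?_
        intro z
        refine (reg_lip h z.1 z.2).trans (le_of_eq ?_)
        simp only [Pi.add_apply]
        ring
    _ = c₁ / 2 * (∫ z, ‖z.1‖ * ‖z.1 - z.2‖ ∂γ) + c₁ / 2 * (∫ z, ‖z.2‖ * ‖z.1 - z.2‖ ∂γ)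
          + c₂ * ∫ z, 1 * ‖z.1 - z.2‖ ∂γ := by
        have j12 : Integrable (fun z : EucSp n × EucSp n =>
            c₁ / 2 * (‖z.1‖ * ‖z.1 - z.2‖) + c₁ / 2 * (‖z.2‖ * ‖z.1 - z.2‖)) γ :=
          (j1.const_mul _).add (j2.const_mul _)
        rw [integral_add j12 (j3.const_mul _),
          integral_add (j1.const_mul _) (j2.const_mul _), integral_const_mul,
          integral_const_mul, integral_const_mul]
    _ ≤ _ := by
        have e : (∫ z : EucSp n × EucSp n, (1 : ℝ) ^ 2 ∂γ) = 1 := by simp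
        rw [e, Real.sqrt_one] at b3
        have a1 := mul_le_mul_of_nonneg_left b1 hc1
        have a2 := mul_le_mul_of_nonneg_left b2 hc1
        have a3 := mul_le_mul_of_nonneg_left b3 hc2
        refine (add_le_add (add_le_add a1 a2) a3).trans (le_of_eq ?_)
        ring

theorem gibbs {n : ℕ} {c₁ c₂ : ℝ} {pU pV : EucSp n → ℝ} {μU μV : Measure (EucSp n)}
    [IsProbabilityMeasure μU] [IsProbabilityMeasure μV]
    (hU : μU = volume.withDensity fun x => ENNReal.ofReal (pU x))
    (hV : μV = volume.withDensity fun x => ENNReal.ofReal (pV x))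
    (hregU : RegularDensity n c₁ c₂ pU) (hregV : RegularDensity n c₁ c₂ pV)
    (hU2 : Integrable (fun x => ‖x‖ ^ 2) μU) :
    ∫ x, Real.log (pV x) ∂μU ≤ ∫ x, Real.log (pU x) ∂μU := by
  have iU := reg_int hregU hU2
  have iV := reg_int hregV hU2
  have cU := reg_cont hregU
  have cV := reg_cont hregV
  have mU : Measurable fun x => ENNReal.ofReal (pU x) := cU.measurable.ennreal_ofReal
  have mV : Measurable fun x => ENNReal.ofReal (pV x) := cV.measurable.ennreal_ofReal
  have fU : ∀ᵐ x ∂(volume : Measure (EucSp n)), ENNReal.ofReal (pU x) < ∞ := by simp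
  have fV : ∀ᵐ x ∂(volume : Measure (EucSp n)), ENNReal.ofReal (pV x) < ∞ := by simp
  have eU : ∀ x, (ENNReal.ofReal (pU x)).toReal • (pV x / pU x) = pV x := by
    intro x
    have := hregU.2.2.1 x
    rw [ENNReal.toReal_ofReal this.le, smul_eq_mul]
    field_simp
  have eV : ∀ x, (ENNReal.ofReal (pV x)).toReal • (1 : ℝ) = pV x := by
    intro x
    rw [ENNReal.toReal_ofReal (hregV.2.2.1 x).le, smul_eq_mul, mul_one]
  have iq : Integrable (fun x => pV x / pU x) μU := by
    rw [hU, integrable_withDensity_iff_integrable_smul' mU fU]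
    simp_rw [eU]
    have : Integrable (fun _ => (1 : ℝ)) μV := integrable_const 1
    rw [hV, integrable_withDensity_iff_integrable_smul' mV fV] at this
    simpa only [eV] using this
  have vq : ∫ x, pV x / pU x ∂μU = 1 := by
    have : ∫ x, (1 : ℝ) ∂μV = 1 := by simp
    rw [hV, integral_withDensity_eq_integral_toReal_smul mV fV] at this
    rw [hU, integral_withDensity_eq_integral_toReal_smul mU fU]
    simp_rw [eU]
    simpa only [eV] using this
  have : ∫ x, (Real.log (pV x) - Real.log (pU x)) ∂μU ≤ ∫ x, (pV x / pU x - 1) ∂μU := by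
    refine integral_mono (iV.sub iU) (iq.sub (integrable_const 1)) ?_
    intro x
    have h1 := hregU.2.2.1 x
    have h2 := hregV.2.2.1 x
    simp only [Pi.sub_apply]
    rw [← Real.log_div h2.ne' h1.ne']
    exact Real.log_le_sub_one_of_pos (div_pos h2 h1)
  rw [integral_sub iV iU, integral_sub iq (integrable_const 1), vq] at this
  simp at this
  exact this

/-- If `U, V` have finite second moments and both have `(c₁,c₂)`-regular
densities, then `|h(U) − h(V)| ≤ Δ`, with
`Δ = ((c₁/2)√E[‖U‖²] + (c₁/2)√E[‖V‖²] + c₂) · W₂(P_U, P_V)`. -/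
theorem stmt4 {n : ℕ} {c₁ c₂ : ℝ} {pU pV : EucSp n → ℝ} {μU μV : Measure (EucSp n)}
    [IsProbabilityMeasure μU] [IsProbabilityMeasure μV]
    (hU : μU = volume.withDensity fun x => ENNReal.ofReal (pU x))
    (hV : μV = volume.withDensity fun x => ENNReal.ofReal (pV x))
    (hregU : RegularDensity n c₁ c₂ pU)
    (hregV : RegularDensity n c₁ c₂ pV)
    (hU2 : Integrable (fun x => ‖x‖ ^ 2) μU)
    (hV2 : Integrable (fun x => ‖x‖ ^ 2) μV) :
    |(- ∫ x, Real.log (pU x) ∂μU) - (- ∫ x, Real.log (pV x) ∂μV)| ≤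
      (c₁ / 2 * Real.sqrt (∫ x, ‖x‖ ^ 2 ∂μU) + c₁ / 2 * Real.sqrt (∫ x, ‖x‖ ^ 2 ∂μV) + c₂) *
        W2 μU μV := by
  have g1 := gibbs hU hV hregU hregV hU2
  have g2 := gibbs hV hU hregV hregU hV2
  set K := c₁ / 2 * Real.sqrt (∫ x, ‖x‖ ^ 2 ∂μU) + c₁ / 2 * Real.sqrt (∫ x, ‖x‖ ^ 2 ∂μV) + c₂
    with hK
  have hc1 : 0 ≤ c₁ / 2 := by linarith [hregU.1]
  have hc2 : 0 ≤ c₂ := hregU.2.1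
  have hK0 : 0 ≤ K := by positivity
  have hne : { r | ∃ γ, IsCoupling μU μV γ ∧
      r = Real.sqrt (∫ z, ‖z.1 - z.2‖ ^ 2 ∂γ) }.Nonempty := by
    refine ⟨_, μU.prod μV, ⟨inferInstance, ?_, ?_⟩, rfl⟩
    · simp [Measure.map_fst_prod]
    · simp [Measure.map_snd_prod]
  have hb : ∀ r ∈ { r | ∃ γ, IsCoupling μU μV γ ∧
      r = Real.sqrt (∫ z, ‖z.1 - z.2‖ ^ 2 ∂γ) },
      |(- ∫ x, Real.log (pU x) ∂μU) - (- ∫ x, Real.log (pV x) ∂μV)| ≤ K * r := by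
    rintro r ⟨γ, hγ, rfl⟩
    have b1 := abs_le.1 (coupling_bound hregU hU2 hV2 hγ)
    have b2 := abs_le.1 (coupling_bound hregV hU2 hV2 hγ)
    rw [← hK] at b1 b2
    rw [abs_le]
    constructor <;> linarith [b1.1, b1.2, b2.1, b2.2]
  rcases hK0.eq_or_lt with h0 | h0
  · obtain ⟨r, hr⟩ := hne
    have := hb r hr
    rw [← h0, zero_mul] at this ⊢
    exact this
  · rw [W2, ← div_le_iff₀' h0]
    refine le_csInf hne fun r hr => ?_
    rw [div_le_iff₀' h0]
    exact hb r hr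
end
end

section
/- Let X, X̃, Z be random vectors in ℝⁿ with Z ∼ N(0, σ²Iₙ) Gaussian, Z independent of X and of X̃, and E[‖X‖²] ≤ nP, E[‖X̃‖²] ≤ nP. Then D(P_{X̃+Z}‖P_{X+Z}) + D(P_{X+Z}‖P_{X̃+Z}) ≤ 2Δ, where Δ = (1/σ²)·(3√(n(σ² + P)) + 4√(nP)) · W₂(P_{X+Z}, P_{X̃+Z}). -/
open MeasureTheory
open scoped ENNReal

noncomputable section

lemma gaussDensity_pos {σ : ℝ} (hσ : 0 < σ) (n : ℕ) (z : EucSp n) : 0 < gaussDensity σ n z := by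
  unfold gaussDensity; positivity

lemma gaussDensity_continuous (σ : ℝ) (n : ℕ) : Continuous (gaussDensity σ n) := by
  unfold gaussDensity; fun_prop

lemma gaussDensity_le {σ : ℝ} (hσ : 0 < σ) (n : ℕ) (z : EucSp n) :
    gaussDensity σ n z ≤ (2 * Real.pi * σ ^ 2) ^ (-(n : ℝ) / 2) := by
  unfold gaussDensity
  have h1 : Real.exp (-‖z‖ ^ 2 / (2 * σ ^ 2)) ≤ 1 := by
    rw [Real.exp_le_one_iff, neg_div]
    exact neg_nonpos.mpr (by positivity)
  exact mul_le_of_le_one_right (by positivity) h1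

lemma gauss_exp {σ : ℝ} (hσ : 0 < σ) (n : ℕ) {h : ℝ} (hh : 2 * σ ^ 2 * h < 1) :
    Integrable (fun z : EucSp n => Real.exp (h * ‖z‖ ^ 2)) (gaussMeasure σ n) ∧
    ∫ z, Real.exp (h * ‖z‖ ^ 2) ∂(gaussMeasure σ n) = (1 - 2 * σ ^ 2 * h) ^ (-(n : ℝ) / 2) := by
  have hm : Measurable fun z : EucSp n => ENNReal.ofReal (gaussDensity σ n z) :=
    (gaussDensity_continuous σ n).measurable.ennreal_ofReal
  have hpos : 0 < 1 - 2 * σ ^ 2 * h := by linarith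
  have hb : 0 < (1 - 2 * σ ^ 2 * h) / (2 * σ ^ 2) := by positivity
  have key := GaussianFourier.integral_rexp_neg_mul_sq_norm (V := EucSp n) hb
  have hint : Integrable (fun v : EucSp n =>
      Real.exp (-((1 - 2 * σ ^ 2 * h) / (2 * σ ^ 2)) * ‖v‖ ^ 2)) := by
    apply Integrable.of_integral_ne_zero
    rw [key]; positivity
  have heq : ∀ z : EucSp n, (ENNReal.ofReal (gaussDensity σ n z)).toReal *
      Real.exp (h * ‖z‖ ^ 2) = (2 * Real.pi * σ ^ 2) ^ (-(n : ℝ) / 2) *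
      Real.exp (-((1 - 2 * σ ^ 2 * h) / (2 * σ ^ 2)) * ‖z‖ ^ 2) := by
    intro z
    rw [ENNReal.toReal_ofReal (gaussDensity_pos hσ n z).le, gaussDensity, mul_assoc,
      ← Real.exp_add]
    congr 2
    field_simp
    ring
  constructor
  · rw [gaussMeasure, integrable_withDensity_iff_integrable_smul' hm (by simp)]
    simp only [smul_eq_mul, heq]
    exact hint.const_mul _
  · rw [gaussMeasure, integral_withDensity_eq_integral_toReal_smul hm (by simp)]
    simp only [smul_eq_mul, heq]
    rw [integral_const_mul, key]
    have : (Module.finrank ℝ (EucSp n) : ℝ) = n := by simp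
    rw [this]
    have e : Real.pi / ((1 - 2 * σ ^ 2 * h) / (2 * σ ^ 2)) =
      (2 * Real.pi * σ ^ 2) * (1 - 2 * σ ^ 2 * h)⁻¹ := by field_simp
    rw [e, Real.mul_rpow (x := 2 * Real.pi * σ ^ 2) (by positivity) (by positivity), ← mul_assoc,
      ← Real.rpow_add (by positivity), neg_div, neg_add_cancel, Real.rpow_zero, one_mul,
      Real.inv_rpow hpos.le, Real.rpow_neg hpos.le]

lemma gauss_prob {σ : ℝ} (hσ : 0 < σ) (n : ℕ) : IsProbabilityMeasure (gaussMeasure σ n) := by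
  have h := (gauss_exp hσ n (h := 0) (by simp)).2
  simp [Measure.real] at h
  constructor
  rwa [ENNReal.toReal_eq_one_iff] at h

lemma gauss_sq_int {σ : ℝ} (hσ : 0 < σ) (n : ℕ) :
    Integrable (fun z : EucSp n => ‖z‖ ^ 2) (gaussMeasure σ n) := by
  have h0 : 2 * σ ^ 2 * (1 / (4 * σ ^ 2)) < 1 := by field_simp; norm_num
  refine ((gauss_exp hσ n h0).1.const_mul (4 * σ ^ 2)).mono' (by fun_prop) (ae_of_all _ fun z => ?_)
  rw [Real.norm_of_nonneg (by positivity)]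
  have := Real.add_one_le_exp (1 / (4 * σ ^ 2) * ‖z‖ ^ 2)
  have h2 : 1 / (4 * σ ^ 2) * ‖z‖ ^ 2 ≤ Real.exp (1 / (4 * σ ^ 2) * ‖z‖ ^ 2) := by linarith
  calc ‖z‖ ^ 2 = 4 * σ ^ 2 * (1 / (4 * σ ^ 2) * ‖z‖ ^ 2) := by field_simp
    _ ≤ _ := by gcongr

lemma gauss_sq_le {σ : ℝ} (hσ : 0 < σ) (n : ℕ) :
    ∫ z : EucSp n, ‖z‖ ^ 2 ∂(gaussMeasure σ n) ≤ n * σ ^ 2 := by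
  have := gauss_prob hσ n
  have hd : HasDerivAt (fun h : ℝ => (1 - 2 * σ ^ 2 * h) ^ (-(n : ℝ) / 2)) (n * σ ^ 2) 0 := by
    have h1 : HasDerivAt (fun h : ℝ => 1 - 2 * σ ^ 2 * h) (-(2 * σ ^ 2)) 0 := by
      simpa using ((hasDerivAt_id (0 : ℝ)).const_mul (2 * σ ^ 2)).const_sub 1
    have h2 := h1.rpow_const (p := -(n : ℝ) / 2) (by left; simp)
    convert h2 using 1
    simp
    ring
  have ht := hd.tendsto_slope_zero_right
  refine ge_of_tendsto ht ?_
  have hpos : (0 : ℝ) < 1 / (2 * σ ^ 2) := by positivity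
  filter_upwards [Ioo_mem_nhdsGT hpos] with h hh
  have hlt : 2 * σ ^ 2 * h < 1 := by
    have := (lt_div_iff₀ (by positivity : (0 : ℝ) < 2 * σ ^ 2)).1 hh.2
    linarith
  obtain ⟨hi, he⟩ := gauss_exp hσ n hlt
  have hmono : ∫ z : EucSp n, (h * ‖z‖ ^ 2 + 1) ∂(gaussMeasure σ n) ≤
      ∫ z : EucSp n, Real.exp (h * ‖z‖ ^ 2) ∂(gaussMeasure σ n) :=
    integral_mono (((gauss_sq_int hσ n).const_mul h).add (integrable_const 1)) hi
      fun z => Real.add_one_le_exp _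
  rw [integral_add ((gauss_sq_int hσ n).const_mul h) (integrable_const 1), integral_const_mul,
    he] at hmono
  simp only [integral_const, probReal_univ, smul_eq_mul, mul_one] at hmono
  simp only [zero_add, mul_zero, sub_zero, Real.one_rpow, smul_eq_mul]
  rw [← div_eq_inv_mul, le_div_iff₀ hh.1]
  linarith

lemma conv_props {σ P : ℝ} (hσ : 0 < σ) {n : ℕ} {μ : Measure (EucSp n)} [IsProbabilityMeasure μ]
    (h2 : Integrable (fun x => ‖x‖ ^ 2) μ) (hp : ∫ x, ‖x‖ ^ 2 ∂μ ≤ n * P) :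
    IsProbabilityMeasure (convMeasure μ (gaussMeasure σ n)) ∧
    Integrable (fun x => ‖x‖ ^ 2) (convMeasure μ (gaussMeasure σ n)) ∧
    ∫ x, ‖x‖ ^ 2 ∂(convMeasure μ (gaussMeasure σ n)) ≤ 2 * (n * (σ ^ 2 + P)) := by
  have := gauss_prob hσ n
  have hm : Measurable fun p : EucSp n × EucSp n => p.1 + p.2 := by fun_prop
  have i1 : Integrable (fun p : EucSp n × EucSp n => 2 * ‖p.1‖ ^ 2 + 2 * ‖p.2‖ ^ 2)
      (μ.prod (gaussMeasure σ n)) :=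
    ((h2.comp_fst _).const_mul 2).add (((gauss_sq_int hσ n).comp_snd _).const_mul 2)
  have hb : ∀ p : EucSp n × EucSp n, ‖p.1 + p.2‖ ^ 2 ≤ 2 * ‖p.1‖ ^ 2 + 2 * ‖p.2‖ ^ 2 := by
    intro p
    have := norm_add_le p.1 p.2
    have := norm_nonneg (p.1 + p.2)
    nlinarith [sq_nonneg (‖p.1‖ - ‖p.2‖)]
  have i2 : Integrable (fun p : EucSp n × EucSp n => ‖p.1 + p.2‖ ^ 2)
      (μ.prod (gaussMeasure σ n)) := by
    refine i1.mono' (by fun_prop) (ae_of_all _ fun p => ?_)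
    rw [Real.norm_of_nonneg (by positivity)]
    exact hb p
  refine ⟨Measure.isProbabilityMeasure_map hm.aemeasurable, ?_, ?_⟩
  · rw [convMeasure, integrable_map_measure (by fun_prop) hm.aemeasurable]
    exact i2
  · rw [convMeasure, integral_map hm.aemeasurable (by fun_prop)]
    refine (integral_mono i2 i1 hb).trans ?_
    rw [integral_add ((h2.comp_fst _).const_mul 2) (((gauss_sq_int hσ n).comp_snd _).const_mul 2),
      integral_const_mul, integral_const_mul, integral_fun_fst (fun x : EucSp n => ‖x‖ ^ 2),
      integral_fun_snd (fun x : EucSp n => ‖x‖ ^ 2)]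
    have := gauss_sq_le hσ n
    simp only [probReal_univ, one_smul]
    linarith

lemma norm_int {n : ℕ} {μ : Measure (EucSp n)} [IsProbabilityMeasure μ]
    (h2 : Integrable (fun x => ‖x‖ ^ 2) μ) : Integrable (fun x => ‖x‖) μ := by
  refine ((integrable_const (1 : ℝ)).add h2).mono' (by fun_prop) (ae_of_all _ fun x => ?_)
  simp only [norm_norm, Pi.add_apply]
  nlinarith [sq_nonneg (‖x‖ - 1)]

/-- the density of `X + Z`. -/
def pD (σ : ℝ) {n : ℕ} (μ : Measure (EucSp n)) (v : EucSp n) : ℝ :=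
  ∫ x, gaussDensity σ n (v - x) ∂μ

lemma gd_int {σ : ℝ} (hσ : 0 < σ) {n : ℕ} (μ : Measure (EucSp n)) [IsProbabilityMeasure μ]
    (v : EucSp n) : Integrable (fun x => gaussDensity σ n (v - x)) μ := by
  have hc : Continuous fun x => gaussDensity σ n (v - x) :=
    (gaussDensity_continuous σ n).comp (by fun_prop)
  refine (integrable_const ((2 * Real.pi * σ ^ 2) ^ (-(n : ℝ) / 2))).mono'
    hc.aestronglyMeasurable (ae_of_all _ fun x => ?_)
  rw [Real.norm_of_nonneg (gaussDensity_pos hσ n _).le]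
  exact gaussDensity_le hσ n _

lemma gdr_int {σ : ℝ} (hσ : 0 < σ) {n : ℕ} (μ : Measure (EucSp n)) [IsProbabilityMeasure μ]
    (h2 : Integrable (fun x => ‖x‖ ^ 2) μ)
    (v : EucSp n) : Integrable (fun x => ‖v - x‖ * gaussDensity σ n (v - x)) μ := by
  have hc : Continuous fun x => gaussDensity σ n (v - x) :=
    (gaussDensity_continuous σ n).comp (by fun_prop)
  have hr : Integrable (fun x => ‖v‖ + ‖x‖) μ := (integrable_const _).add (norm_int h2)
  refine (hr.mul_const ((2 * Real.pi * σ ^ 2) ^ (-(n : ℝ) / 2))).mono'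
    (by fun_prop) (ae_of_all _ fun x => ?_)
  rw [Real.norm_of_nonneg (mul_nonneg (norm_nonneg _) (gaussDensity_pos hσ n _).le)]
  exact mul_le_mul (norm_sub_le _ _) (gaussDensity_le hσ n _) (gaussDensity_pos hσ n _).le
    (by positivity)

lemma pD_pos {σ : ℝ} (hσ : 0 < σ) {n : ℕ} (μ : Measure (EucSp n)) [IsProbabilityMeasure μ]
    (v : EucSp n) : 0 < pD σ μ v := by
  unfold pD
  rw [integral_pos_iff_support_of_nonneg (fun x => (gaussDensity_pos hσ n _).le) (gd_int hσ μ v)]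
  have : Function.support (fun x => gaussDensity σ n (v - x)) = Set.univ := by
    ext x; simp [(gaussDensity_pos hσ n (v - x)).ne']
  rw [this]; simp

lemma pD_meas (σ : ℝ) {n : ℕ} (μ : Measure (EucSp n)) [IsProbabilityMeasure μ] :
    Measurable (pD σ μ) := by
  have hc : Continuous (Function.uncurry fun v x : EucSp n => gaussDensity σ n (v - x)) :=
    (gaussDensity_continuous σ n).comp (by fun_prop)
  exact (hc.stronglyMeasurable.integral_prod_right).measurable

lemma cheb_pw {σ : ℝ} (hσ : 0 < σ) (n : ℕ) (a : ℝ) (ha : 0 ≤ a) :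
    ∃ W : ℝ, 0 ≤ W ∧ ∀ y : EucSp n, ‖y‖ * gaussDensity σ n y ≤
      a * gaussDensity σ n y + W * (‖y‖ - a) := by
  refine ⟨(2 * Real.pi * σ ^ 2) ^ (-(n : ℝ) / 2) * Real.exp (-a ^ 2 / (2 * σ ^ 2)),
    by positivity, fun y => ?_⟩
  rw [gaussDensity]
  have hK0 : 0 ≤ (2 * Real.pi * σ ^ 2) ^ (-(n : ℝ) / 2) := by positivity
  generalize (2 * Real.pi * σ ^ 2) ^ (-(n : ℝ) / 2) = K at *
  have hy := norm_nonneg y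
  generalize ‖y‖ = r at *
  have h1 : (r - a) * (Real.exp (-r ^ 2 / (2 * σ ^ 2)) - Real.exp (-a ^ 2 / (2 * σ ^ 2))) ≤ 0 := by
    rcases le_total r a with h | h
    · refine mul_nonpos_of_nonpos_of_nonneg (by linarith) (sub_nonneg.2 (Real.exp_le_exp.2
        (div_le_div_of_nonneg_right ?_ (by positivity))))
      nlinarith
    · refine mul_nonpos_of_nonneg_of_nonpos (by linarith) (sub_nonpos.2 (Real.exp_le_exp.2
        (div_le_div_of_nonneg_right ?_ (by positivity))))
      nlinarith
  have := mul_nonneg hK0 (neg_nonneg.2 h1)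
  linarith

/-- Chebyshev association inequality -/
lemma cheb {σ : ℝ} (hσ : 0 < σ) {n : ℕ} (μ : Measure (EucSp n)) [IsProbabilityMeasure μ]
    (h2 : Integrable (fun x => ‖x‖ ^ 2) μ) (v : EucSp n) :
    ∫ x, ‖v - x‖ * gaussDensity σ n (v - x) ∂μ ≤ (‖v‖ + ∫ x, ‖x‖ ∂μ) * pD σ μ v := by
  set a := ‖v‖ + ∫ x, ‖x‖ ∂μ with ha
  have ha0 : 0 ≤ a := by positivity
  obtain ⟨W, hW⟩ := cheb_pw hσ n a ha0
  have pw : ∀ x, ‖v - x‖ * gaussDensity σ n (v - x) ≤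
      a * gaussDensity σ n (v - x) + W * ((‖v‖ + ‖x‖) - a) := by
    intro x
    have hr : ‖v - x‖ ≤ ‖v‖ + ‖x‖ := norm_sub_le _ _
    have h1 := hW.2 (v - x)
    have h2 := mul_le_mul_of_nonneg_left hr hW.1
    linarith
  have i1 := (gd_int hσ μ v).const_mul a
  have i3 : Integrable (fun x => ‖v‖ + ‖x‖) μ := (integrable_const _).add (norm_int h2)
  have i4 : Integrable (fun x => (‖v‖ + ‖x‖) - a) μ := i3.sub (integrable_const _)
  have i2 := i4.const_mul W
  refine (integral_mono (gdr_int hσ μ h2 v) (i1.add i2) pw).trans ?_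
  simp only [Pi.add_apply]
  rw [integral_add i1 i2, integral_const_mul, integral_const_mul, integral_sub i3
    (integrable_const _), integral_add (integrable_const _) (norm_int h2)]
  simp [pD, ha]

lemma log_pD {σ : ℝ} (hσ : 0 < σ) {n : ℕ} (μ : Measure (EucSp n)) [IsProbabilityMeasure μ]
    (h2 : Integrable (fun x => ‖x‖ ^ 2) μ) (u v : EucSp n) :
    Real.log (pD σ μ v) - Real.log (pD σ μ u) ≤
      (‖u‖ + 3 * ‖v‖ + 2 * ∫ x, ‖x‖ ∂μ) * ‖u - v‖ / (2 * σ ^ 2) := by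
  set M := ∫ x, ‖x‖ ∂μ
  set L := (‖u‖ + 3 * ‖v‖ + 2 * M) * ‖u - v‖ / (2 * σ ^ 2) with hL
  set k := ‖u - v‖ / (2 * σ ^ 2) with hk
  have hk0 : 0 ≤ k := by positivity
  have hLk : L = (‖u‖ + 3 * ‖v‖ + 2 * M) * k := by rw [hL, hk]; ring
  have pw : ∀ x, Real.exp (-L) * ((1 + L - k * (‖u‖ + ‖v‖)) * gaussDensity σ n (v - x)
      - 2 * k * (‖v - x‖ * gaussDensity σ n (v - x))) ≤ gaussDensity σ n (u - x) := by
    intro x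
    set φ := (‖v - x‖ ^ 2 - ‖u - x‖ ^ 2) / (2 * σ ^ 2) with hφ
    have e1 : gaussDensity σ n (u - x) = gaussDensity σ n (v - x) * Real.exp φ := by
      rw [gaussDensity, gaussDensity, mul_assoc (_ ^ _), ← Real.exp_add, hφ]
      congr 2
      field_simp
      ring
    have e2 : -(k * (‖u‖ + ‖v‖ + 2 * ‖v - x‖)) ≤ φ := by
      have t1 : ‖u - x‖ ≤ ‖u‖ + ‖v‖ + ‖v - x‖ := by
        have := norm_add_le (u - v) (v - x)
        have := norm_sub_le u v
        simp only [sub_add_sub_cancel] at *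
        linarith
      have t2 : ‖u - x‖ - ‖v - x‖ ≤ ‖u - v‖ := by
        have := norm_sub_norm_le (u - x) (v - x)
        simpa using this
      have t3 : ‖u - x‖ ^ 2 - ‖v - x‖ ^ 2 ≤ ‖u - v‖ * (‖u‖ + ‖v‖ + 2 * ‖v - x‖) := by
        have q : ‖u - x‖ ^ 2 - ‖v - x‖ ^ 2 = (‖u - x‖ - ‖v - x‖) * (‖u - x‖ + ‖v - x‖) := by ring
        rw [q]
        calc _ ≤ ‖u - v‖ * (‖u - x‖ + ‖v - x‖) := by gcongr
          _ ≤ _ := mul_le_mul_of_nonneg_left (by linarith) (norm_nonneg _)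
      rw [hφ, hk, neg_le, ← neg_div, div_mul_eq_mul_div]
      gcongr
      linarith
    have e3 : Real.exp (-L) * (1 + φ + L) ≤ Real.exp φ := by
      have := Real.add_one_le_exp (φ + L)
      calc _ ≤ Real.exp (-L) * Real.exp (φ + L) := by gcongr; linarith
        _ = _ := by rw [← Real.exp_add]; congr 1; ring
    have hg := (gaussDensity_pos hσ n (v - x)).le
    rw [e1]
    calc _ = gaussDensity σ n (v - x) * (Real.exp (-L) *
          (1 + L - (k * (‖u‖ + ‖v‖ + 2 * ‖v - x‖)))) := by ring
      _ ≤ gaussDensity σ n (v - x) * (Real.exp (-L) * (1 + φ + L)) := by gcongr; linarith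
      _ ≤ _ := by gcongr
  have i1 := (gd_int hσ μ v).const_mul (1 + L - k * (‖u‖ + ‖v‖))
  have i2 := (gdr_int hσ μ h2 v).const_mul (2 * k)
  have hI := integral_mono ((i1.sub i2).const_mul (Real.exp (-L))) (gd_int hσ μ u) pw
  simp only [Pi.sub_apply] at hI
  rw [integral_const_mul, integral_sub i1 i2, integral_const_mul, integral_const_mul] at hI
  have hc := cheb hσ μ h2 v
  have hpv := pD_pos hσ μ v
  have hpu := pD_pos hσ μ u
  have hle : Real.exp (-L) * pD σ μ v ≤ pD σ μ u := by
    refine le_trans ?_ hI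
    gcongr
    have := mul_le_mul_of_nonneg_left hc (by positivity : 0 ≤ 2 * k)
    change _ ≤ (1 + L - k * (‖u‖ + ‖v‖)) * pD σ μ v - _
    rw [hLk]
    linarith
  have := Real.log_le_log (by positivity) hle
  rw [Real.log_mul (by positivity) hpv.ne', Real.log_exp] at this
  linarith

lemma log_pD_int {σ : ℝ} (hσ : 0 < σ) {n : ℕ} (μ : Measure (EucSp n)) [IsProbabilityMeasure μ]
    (h2 : Integrable (fun x => ‖x‖ ^ 2) μ) (Q : Measure (EucSp n)) [IsProbabilityMeasure Q]
    (hQ : Integrable (fun x => ‖x‖ ^ 2) Q) : Integrable (fun v => Real.log (pD σ μ v)) Q := by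
  set M := ∫ x, ‖x‖ ∂μ with hM
  have hM0 : 0 ≤ M := by positivity
  have i : Integrable (fun v => |Real.log (pD σ μ 0)| +
      (3 * ‖v‖ ^ 2 + 2 * M * ‖v‖) / (2 * σ ^ 2)) Q :=
    (integrable_const _).add (((hQ.const_mul 3).add ((norm_int hQ).const_mul _)).div_const _)
  refine i.mono' (Real.measurable_log.comp (pD_meas σ μ)).aestronglyMeasurable
    (ae_of_all _ fun v => ?_)
  have a1 := log_pD hσ μ h2 0 v
  have a2 := log_pD hσ μ h2 v 0
  simp only [norm_zero, zero_sub, sub_zero, norm_neg, mul_zero, zero_add, add_zero, ← hM] at a1 a2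
  have b1 : (3 * ‖v‖ + 2 * M) * ‖v‖ / (2 * σ ^ 2) = (3 * ‖v‖ ^ 2 + 2 * M * ‖v‖) / (2 * σ ^ 2) := by
    ring
  have b2 : (‖v‖ + 2 * M) * ‖v‖ / (2 * σ ^ 2) ≤ (3 * ‖v‖ ^ 2 + 2 * M * ‖v‖) / (2 * σ ^ 2) := by
    gcongr
    nlinarith [sq_nonneg ‖v‖]
  rw [Real.norm_eq_abs, abs_le]
  have := le_abs_self (Real.log (pD σ μ 0))
  have := neg_abs_le (Real.log (pD σ μ 0))
  constructor <;> linarith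

lemma cs {α : Type*} [MeasurableSpace α] {γ : Measure α} {f g : α → ℝ}
    (hfm : AEStronglyMeasurable f γ) (hgm : AEStronglyMeasurable g γ)
    (hf0 : ∀ x, 0 ≤ f x) (hg0 : ∀ x, 0 ≤ g x)
    (hf : Integrable (fun x => f x ^ 2) γ) (hg : Integrable (fun x => g x ^ 2) γ) :
    Integrable (fun x => f x * g x) γ ∧
    ∫ x, f x * g x ∂γ ≤ Real.sqrt (∫ x, f x ^ 2 ∂γ) * Real.sqrt (∫ x, g x ^ 2 ∂γ) := by
  have mf : MemLp f 2 γ := (memLp_two_iff_integrable_sq hfm).2 hf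
  have mg : MemLp g 2 γ := (memLp_two_iff_integrable_sq hgm).2 hg
  refine ⟨mf.integrable_mul mg, ?_⟩
  have := integral_mul_le_Lp_mul_Lq_of_nonneg (μ := γ) (p := 2) (q := 2)
    Real.HolderConjugate.two_two (ae_of_all _ hf0) (ae_of_all _ hg0) (by simpa using mf)
    (by simpa using mg)
  simpa [Real.sqrt_eq_rpow] using this

lemma mean_le {n : ℕ} {P : ℝ} {μ : Measure (EucSp n)} [IsProbabilityMeasure μ]
    (h2 : Integrable (fun x => ‖x‖ ^ 2) μ) (hp : ∫ x, ‖x‖ ^ 2 ∂μ ≤ n * P) :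
    ∫ x, ‖x‖ ∂μ ≤ Real.sqrt (n * P) := by
  have := (cs (γ := μ) (f := fun x => ‖x‖) (g := fun _ => 1) (by fun_prop) (by fun_prop)
    (fun x => norm_nonneg x) (by simp) h2 (by simp)).2
  simp at this
  exact this.trans (Real.sqrt_le_sqrt hp)

lemma coupling_bound_s10 {n : ℕ} {σ P : ℝ} (hσ : 0 < σ) (hP : 0 ≤ P)
    {μX μX' : Measure (EucSp n)} [IsProbabilityMeasure μX] [IsProbabilityMeasure μX']
    (hX2 : Integrable (fun x => ‖x‖ ^ 2) μX) (hX'2 : Integrable (fun x => ‖x‖ ^ 2) μX')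
    (hXP : ∫ x, ‖x‖ ^ 2 ∂μX ≤ n * P) (hX'P : ∫ x, ‖x‖ ^ 2 ∂μX' ≤ n * P)
    {Q Q' : Measure (EucSp n)} [IsProbabilityMeasure Q] [IsProbabilityMeasure Q']
    (hQ : Integrable (fun x => ‖x‖ ^ 2) Q) (hQ' : Integrable (fun x => ‖x‖ ^ 2) Q')
    (hQb : ∫ x, ‖x‖ ^ 2 ∂Q ≤ 2 * (n * (σ ^ 2 + P)))
    (hQ'b : ∫ x, ‖x‖ ^ 2 ∂Q' ≤ 2 * (n * (σ ^ 2 + P)))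
    {γ : Measure (EucSp n × EucSp n)} (hγ : IsCoupling Q Q' γ) :
    (∫ v, Real.log (pD σ μX' v / pD σ μX v) ∂Q') + (∫ v, Real.log (pD σ μX v / pD σ μX' v) ∂Q) ≤
      2 * (1 / σ ^ 2 * (3 * Real.sqrt (n * (σ ^ 2 + P)) + 4 * Real.sqrt (n * P))) *
        Real.sqrt (∫ z, ‖z.1 - z.2‖ ^ 2 ∂γ) := by
  obtain ⟨hpr, h1, h2⟩ := hγ
  have m1 : AEMeasurable (Prod.fst : EucSp n × EucSp n → EucSp n) γ := by fun_prop
  have m2 : AEMeasurable (Prod.snd : EucSp n × EucSp n → EucSp n) γ := by fun_prop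
  have tI1 : ∀ f : EucSp n → ℝ, Integrable f Q → Integrable (fun z => f z.1) γ := by
    intro f hf; rw [← h1] at hf; exact hf.comp_aemeasurable m1
  have tI2 : ∀ f : EucSp n → ℝ, Integrable f Q' → Integrable (fun z => f z.2) γ := by
    intro f hf; rw [← h2] at hf; exact hf.comp_aemeasurable m2
  have tE1 : ∀ f : EucSp n → ℝ, Integrable f Q → ∫ v, f v ∂Q = ∫ z, f z.1 ∂γ := by
    intro f hf
    rw [← h1] at hf ⊢
    exact integral_map m1 hf.aestronglyMeasurable
  have tE2 : ∀ f : EucSp n → ℝ, Integrable f Q' → ∫ v, f v ∂Q' = ∫ z, f z.2 ∂γ := by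
    intro f hf
    rw [← h2] at hf ⊢
    exact integral_map m2 hf.aestronglyMeasurable
  have l1 : ∀ v, Real.log (pD σ μX' v / pD σ μX v) =
      Real.log (pD σ μX' v) - Real.log (pD σ μX v) := fun v =>
    Real.log_div (pD_pos hσ μX' v).ne' (pD_pos hσ μX v).ne'
  have l2 : ∀ v, Real.log (pD σ μX v / pD σ μX' v) =
      Real.log (pD σ μX v) - Real.log (pD σ μX' v) := fun v =>
    Real.log_div (pD_pos hσ μX v).ne' (pD_pos hσ μX' v).ne'
  simp only [l1, l2]
  have j1 : Integrable (fun v => Real.log (pD σ μX' v) - Real.log (pD σ μX v)) Q' :=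
    (log_pD_int hσ μX' hX'2 Q' hQ').sub (log_pD_int hσ μX hX2 Q' hQ')
  have j2 : Integrable (fun v => Real.log (pD σ μX v) - Real.log (pD σ μX' v)) Q :=
    (log_pD_int hσ μX hX2 Q hQ).sub (log_pD_int hσ μX' hX'2 Q hQ)
  rw [tE2 _ j1, tE1 _ j2, ← integral_add (tI2 _ j1) (tI1 _ j2)]
  set M := ∫ x, ‖x‖ ∂μX with hM
  set M' := ∫ x, ‖x‖ ∂μX' with hM'
  have hMb : M ≤ Real.sqrt (n * P) := mean_le hX2 hXP
  have hMb' : M' ≤ Real.sqrt (n * P) := mean_le hX'2 hX'P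
  have iD : Integrable (fun z : EucSp n × EucSp n => ‖z.1 - z.2‖ ^ 2) γ := by
    refine (((tI1 _ hQ).const_mul 2).add ((tI2 _ hQ').const_mul 2)).mono' (by fun_prop)
      (ae_of_all _ fun z => ?_)
    rw [Real.norm_of_nonneg (by positivity)]
    simp only [Pi.add_apply]
    have := norm_sub_le z.1 z.2
    have := norm_nonneg (z.1 - z.2)
    nlinarith [sq_nonneg (‖z.1‖ - ‖z.2‖)]
  obtain ⟨c1i, c1⟩ := cs (γ := γ) (f := fun z => ‖z.1‖) (g := fun z => ‖z.1 - z.2‖) (by fun_prop)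
    (by fun_prop) (fun z => norm_nonneg _) (fun z => norm_nonneg _) (tI1 _ hQ) iD
  obtain ⟨c2i, c2⟩ := cs (γ := γ) (f := fun z => ‖z.2‖) (g := fun z => ‖z.1 - z.2‖) (by fun_prop)
    (by fun_prop) (fun z => norm_nonneg _) (fun z => norm_nonneg _) (tI2 _ hQ') iD
  obtain ⟨c3i, c3⟩ := cs (γ := γ) (f := fun z => 1) (g := fun z => ‖z.1 - z.2‖) (by fun_prop)
    (by fun_prop) (fun z => zero_le_one) (fun z => norm_nonneg _) (by simp) iD
  simp only [one_mul, one_pow, integral_const, probReal_univ, smul_eq_mul, mul_one,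
    Real.sqrt_one] at c3 c3i
  rw [← tE1 _ hQ] at c1
  rw [← tE2 _ hQ'] at c2
  set D := Real.sqrt (∫ z, ‖z.1 - z.2‖ ^ 2 ∂γ) with hD
  have hD0 : 0 ≤ D := Real.sqrt_nonneg _
  set A := Real.sqrt (n * (σ ^ 2 + P)) with hA
  set B := Real.sqrt (n * P) with hB
  have hA0 : 0 ≤ A := Real.sqrt_nonneg _
  have hB0 : 0 ≤ B := Real.sqrt_nonneg _
  have hs : Real.sqrt (2 * (n * (σ ^ 2 + P))) ≤ 3 / 2 * A := by
    rw [Real.sqrt_le_left (by positivity), mul_pow, hA, Real.sq_sqrt (by positivity)]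
    have : 0 ≤ (n : ℝ) * (σ ^ 2 + P) := by positivity
    linarith
  have d1 : ∫ z, ‖z.1‖ * ‖z.1 - z.2‖ ∂γ ≤ 3 / 2 * A * D :=
    c1.trans (mul_le_mul_of_nonneg_right ((Real.sqrt_le_sqrt hQb).trans hs) hD0)
  have d2 : ∫ z, ‖z.2‖ * ‖z.1 - z.2‖ ∂γ ≤ 3 / 2 * A * D :=
    c2.trans (mul_le_mul_of_nonneg_right ((Real.sqrt_le_sqrt hQ'b).trans hs) hD0)
  have hM0 : 0 ≤ M := by positivity
  have hM0' : 0 ≤ M' := by positivity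
  have hJ : Integrable (fun z : EucSp n × EucSp n => (2 * (‖z.1‖ * ‖z.1 - z.2‖) +
      2 * (‖z.2‖ * ‖z.1 - z.2‖) + (M + M') * ‖z.1 - z.2‖) / σ ^ 2) γ :=
    (((c1i.const_mul 2).add (c2i.const_mul 2)).add (c3i.const_mul (M + M'))).div_const _
  refine (integral_mono ((tI2 _ j1).add (tI1 _ j2)) hJ fun z => ?_).trans ?_
  · simp only [Pi.add_apply]
    have e1 := log_pD hσ μX' hX'2 z.1 z.2
    have e2 := log_pD hσ μX hX2 z.2 z.1
    rw [norm_sub_rev z.2 z.1, ← hM] at e2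
    rw [← hM'] at e1
    have : (2 * (‖z.1‖ * ‖z.1 - z.2‖) + 2 * (‖z.2‖ * ‖z.1 - z.2‖) +
        (M + M') * ‖z.1 - z.2‖) / σ ^ 2 =
        (‖z.1‖ + 3 * ‖z.2‖ + 2 * M') * ‖z.1 - z.2‖ / (2 * σ ^ 2) +
        (‖z.2‖ + 3 * ‖z.1‖ + 2 * M) * ‖z.1 - z.2‖ / (2 * σ ^ 2) := by
      field_simp; ring
    rw [this]
    linarith
  · have s1 := c1i.const_mul 2
    have s2 := c2i.const_mul 2
    have s3 := c3i.const_mul (M + M')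
    rw [integral_div, integral_add (f := fun z : EucSp n × EucSp n => 2 * (‖z.1‖ * ‖z.1 - z.2‖) +
      2 * (‖z.2‖ * ‖z.1 - z.2‖)) (s1.add s2) s3, integral_add s1 s2, integral_const_mul,
      integral_const_mul, integral_const_mul]
    have d3 : (M + M') * ∫ z, ‖z.1 - z.2‖ ∂γ ≤ (B + B) * D := by
      refine mul_le_mul (by linarith) c3 (integral_nonneg fun z => norm_nonneg _) (by positivity)
    have : 2 * (1 / σ ^ 2 * (3 * A + 4 * B)) * D = (6 * A * D + 8 * B * D) / σ ^ 2 := by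
      field_simp; ring
    rw [this]
    refine div_le_div_of_nonneg_right ?_ (by positivity)
    have := mul_nonneg hB0 hD0
    linarith

/-- Let `X, X̃ ⟂ Z` with `Z ∼ N(0, σ²Iₙ)` and `E[‖X‖²] ≤ nP`,
`E[‖X̃‖²] ≤ nP`. Then `D(P_{X̃+Z}‖P_{X+Z}) + D(P_{X+Z}‖P_{X̃+Z}) ≤ 2Δ` with
`Δ = (1/σ²)(3√(n(σ²+P)) + 4√(nP)) · W₂(P_{X+Z}, P_{X̃+Z})`.
The law of `X+Z` is the convolution `μX ∗ N(0,σ²Iₙ)`, with everywhere-positive density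
`v ↦ E[p_Z(v − X)]`, so `D(P_{X̃+Z}‖P_{X+Z}) = ∫ log (p_{X̃+Z}/p_{X+Z}) dP_{X̃+Z}`. -/
theorem stmt10 {n : ℕ} {σ P : ℝ} (hσ : 0 < σ) (hP : 0 ≤ P)
    {μX μX' : Measure (EucSp n)} [IsProbabilityMeasure μX] [IsProbabilityMeasure μX']
    (hX2 : Integrable (fun x => ‖x‖ ^ 2) μX) (hX'2 : Integrable (fun x => ‖x‖ ^ 2) μX')
    (hXP : ∫ x, ‖x‖ ^ 2 ∂μX ≤ n * P) (hX'P : ∫ x, ‖x‖ ^ 2 ∂μX' ≤ n * P) :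
    (∫ v, Real.log ((∫ x, gaussDensity σ n (v - x) ∂μX') / ∫ x, gaussDensity σ n (v - x) ∂μX)
        ∂(convMeasure μX' (gaussMeasure σ n))) +
      (∫ v, Real.log ((∫ x, gaussDensity σ n (v - x) ∂μX) / ∫ x, gaussDensity σ n (v - x) ∂μX')
        ∂(convMeasure μX (gaussMeasure σ n))) ≤
      2 * (1 / σ ^ 2 * (3 * Real.sqrt (n * (σ ^ 2 + P)) + 4 * Real.sqrt (n * P)) *
        W2 (convMeasure μX (gaussMeasure σ n)) (convMeasure μX' (gaussMeasure σ n))) := by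

  obtain ⟨p1, q1, r1⟩ := conv_props hσ hX2 hXP
  obtain ⟨p2, q2, r2⟩ := conv_props hσ hX'2 hX'P
  set Q := convMeasure μX (gaussMeasure σ n)
  set Q' := convMeasure μX' (gaussMeasure σ n)
  have key : ∀ r ∈ { r | ∃ γ, IsCoupling Q Q' γ ∧ r = Real.sqrt (∫ z, ‖z.1 - z.2‖ ^ 2 ∂γ) },
      (∫ v, Real.log (pD σ μX' v / pD σ μX v) ∂Q') +
      (∫ v, Real.log (pD σ μX v / pD σ μX' v) ∂Q) ≤
      2 * (1 / σ ^ 2 * (3 * Real.sqrt (n * (σ ^ 2 + P)) + 4 * Real.sqrt (n * P))) * r := by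
    rintro r ⟨γ, hγ, rfl⟩
    exact coupling_bound_s10 hσ hP hX2 hX'2 hXP hX'P q1 q2 r1 r2 hγ
  have hne : { r | ∃ γ, IsCoupling Q Q' γ ∧
      r = Real.sqrt (∫ z, ‖z.1 - z.2‖ ^ 2 ∂γ) }.Nonempty :=
    ⟨_, Q.prod Q', ⟨inferInstance, by simp, by simp⟩, rfl⟩
  rw [← mul_assoc]
  have hK : 0 ≤ 2 * (1 / σ ^ 2 * (3 * Real.sqrt (n * (σ ^ 2 + P)) + 4 * Real.sqrt (n * P))) := by
    positivity
  change (∫ v, Real.log (pD σ μX' v / pD σ μX v) ∂Q') +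
      (∫ v, Real.log (pD σ μX v / pD σ μX' v) ∂Q) ≤ _
  rcases hK.eq_or_lt with h0 | h0
  · obtain ⟨r, hr⟩ := hne
    have := key r hr
    rw [← h0] at this ⊢
    simpa using this
  · rw [← div_le_iff₀' h0]
    exact le_csInf hne fun r hr => (div_le_iff₀' h0).2 (key r hr)
end
end
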